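/- arXiv:math/0701451 — 2 statements merged into one kernel-verified Lean document; each statement's English description precedes it below -/
import Mathlib

section
/- Let (X,d) be a complete separable metric space, I=[a,b] a compact interval with normalized Lebesgue measure λ, and let f: I×X → ℝ be a Caratheodory integrand (a Borel function continuous in the second variable) such that |f(t,x)|/(1+d(x₀,x)) is bounded for some x₀ ∈ X. Then the map η ↦ ∫_{I×X} f dη is continuous on the space 𝒴₁(I,X) of Young measures. -/
open MeasureTheory Filter Topology Set ENNReal

noncomputable section

/-!
`(X,d)` is a complete separable metric space, `I = [a,b]` carries the normalized
Lebesgue measure `lam a b`.  A Young measure is a Borel probability measure on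
`I × X` (modelled on `ℝ × X`) with finite first moment whose marginal on `I` is
`lam a b`.  Convergence in the Kantorovich–Rubinstein space `𝒴₁(I,X)` is expressed
through convergence of the integrals of all continuous functions of at most linear
growth (which generates its topology).  A map on `𝒴₁(I,X)` is continuous iff it is
sequentially continuous, since the Kantorovich–Rubinstein distance is a metric.
-/

/-- Normalized Lebesgue measure on the interval `[a,b]`. -/
def lam (a b : ℝ) : Measure ℝ := (ENNReal.ofReal (b - a))⁻¹ • (volume.restrict (Icc a b))

/-- Young measures on `I × X` with finite first moment whose marginal on `I` is
the normalized Lebesgue measure. -/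
def IsYoungMeasure {X : Type*} [MetricSpace X] [MeasurableSpace X]
    (a b : ℝ) (x₀ : X) (η : Measure (ℝ × X)) : Prop :=
  IsProbabilityMeasure η ∧ η.map Prod.fst = lam a b ∧
    Integrable (fun p : ℝ × X => dist x₀ p.2) η

/-- Convergence in the Kantorovich–Rubinstein space `𝒴₁(I,X)`. -/
def Y1Tendsto {X : Type*} [MetricSpace X] [MeasurableSpace X] (x₀ : X)
    (ηs : ℕ → Measure (ℝ × X)) (η : Measure (ℝ × X)) : Prop :=
  ∀ f : ℝ × X → ℝ, Continuous f → (∃ C : ℝ, ∀ p, |f p| ≤ C * (1 + dist x₀ p.2)) →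
    Tendsto (fun n => ∫ p, f p ∂(ηs n)) atTop (𝓝 (∫ p, f p ∂η))

/-- Functions approximable by bounded continuous ones up to an error depending on time only. -/
def Apx {X : Type*} [MetricSpace X] (μ : Measure ℝ) (F : ℝ × X → ℝ) : Prop :=
  ∀ ε > 0, ∃ (G : ℝ × X → ℝ) (k : ℝ → ℝ), Continuous G ∧ (∃ B : ℝ, ∀ p, |G p| ≤ B) ∧
    Integrable k μ ∧ (∀ p, |F p - G p| ≤ k p.1) ∧ ∫ t, k t ∂μ ≤ ε

lemma Apx.zero {X : Type*} [MetricSpace X] (μ : Measure ℝ) :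
    Apx μ (fun _ : ℝ × X => (0 : ℝ)) := by
  intro ε hε
  exact ⟨fun _ => 0, fun _ => 0, continuous_const, ⟨0, by simp⟩, integrable_zero _ _ _,
    by simp, by simpa using hε.le⟩

lemma Apx.max {X : Type*} [MetricSpace X] {μ : Measure ℝ} {F₁ F₂ : ℝ × X → ℝ}
    (h₁ : Apx μ F₁) (h₂ : Apx μ F₂) : Apx μ (fun p => max (F₁ p) (F₂ p)) := by
  intro ε hε
  obtain ⟨G₁, k₁, c₁, ⟨B₁, b₁⟩, i₁, e₁, s₁⟩ := h₁ (ε / 2) (by positivity)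
  obtain ⟨G₂, k₂, c₂, ⟨B₂, b₂⟩, i₂, e₂, s₂⟩ := h₂ (ε / 2) (by positivity)
  refine ⟨fun p => Max.max (G₁ p) (G₂ p), fun t => k₁ t + k₂ t, c₁.max c₂,
    ⟨Max.max B₁ B₂, fun p => ?_⟩, i₁.add i₂, fun p => ?_, ?_⟩
  · exact (abs_max_le_max_abs_abs).trans (max_le_max (b₁ p) (b₂ p))
  · have h1 := e₁ p
    have h2 := e₂ p
    have h3 := (abs_nonneg _).trans h1
    have h4 := (abs_nonneg _).trans h2
    refine (abs_max_sub_max_le_max _ _ _ _).trans (max_le ?_ ?_) <;> linarith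
  · rw [integral_add i₁ i₂]; linarith

lemma Apx.prod {X : Type*} [MetricSpace X] {μ : Measure ℝ} [IsFiniteMeasure μ]
    {g : ℝ → ℝ} (hg : Integrable g μ) {h : X → ℝ} (hc : Continuous h)
    (hb : ∀ x, |h x| ≤ 1) : Apx μ (fun p : ℝ × X => g p.1 * h p.2) := by
  intro ε hε
  obtain ⟨G, hG, hGi⟩ := hg.exists_boundedContinuous_integral_sub_le hε
  refine ⟨fun p => G p.1 * h p.2, fun t => ‖g t - G t‖, by fun_prop,
    ⟨‖G‖, fun p => ?_⟩, (hg.sub hGi).norm, fun p => ?_, hG⟩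
  · rw [abs_mul]
    have := G.norm_coe_le_norm p.1
    rw [Real.norm_eq_abs] at this
    nlinarith [hb p.2, abs_nonneg (h p.2), abs_nonneg (G p.1)]
  · rw [← sub_mul, abs_mul]
    change _ ≤ |g p.1 - G p.1|
    nlinarith [hb p.2, abs_nonneg (g p.1 - G p.1)]

lemma Apx.integrable {X : Type*} [MetricSpace X] [SecondCountableTopology X]
    [MeasurableSpace X] [BorelSpace X] {μ : Measure ℝ} {F : ℝ × X → ℝ}
    (hF : Measurable F) (h : Apx μ F) (ν : Measure (ℝ × X)) [IsProbabilityMeasure ν]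
    (hν : ν.map Prod.fst = μ) : Integrable F ν ∧ ∀ ε > 0, ∀ (G : ℝ × X → ℝ) (k : ℝ → ℝ),
      Continuous G → (∃ B : ℝ, ∀ p, |G p| ≤ B) → Integrable k μ →
      (∀ p, |F p - G p| ≤ k p.1) → ∫ t, k t ∂μ ≤ ε → |∫ p, F p ∂ν - ∫ p, G p ∂ν| ≤ ε := by
  subst hν
  have key : ∀ (G : ℝ × X → ℝ) (k : ℝ → ℝ),
      Continuous G → (∃ B : ℝ, ∀ p, |G p| ≤ B) → Integrable k (ν.map Prod.fst) →
      (∀ p, |F p - G p| ≤ k p.1) → Integrable G ν ∧ Integrable (fun p => F p - G p) ν ∧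
        Integrable (fun p => k p.1) ν := by
    rintro G k hG ⟨B, hB⟩ hk hFG
    have i1 : Integrable (fun p : ℝ × X => k p.1) ν := hk.comp_measurable measurable_fst
    refine ⟨Integrable.of_bound hG.measurable.aestronglyMeasurable B
      (Eventually.of_forall hB), i1.mono' (hF.sub hG.measurable).aestronglyMeasurable
      (Eventually.of_forall hFG), i1⟩
  have hFi : Integrable F ν := by
    obtain ⟨G, k, c, B, i, e, -⟩ := h 1 one_pos
    obtain ⟨h1, h2, -⟩ := key G k c B i e
    refine (h2.add h1).congr (Eventually.of_forall fun p => ?_)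
    simp
  refine ⟨hFi, fun ε hε G k c B i e s => ?_⟩
  obtain ⟨h1, h2, h3⟩ := key G k c B i e
  rw [← integral_sub hFi h1]
  refine (abs_integral_le_integral_abs).trans ((integral_mono h2.abs h3 e).trans ?_)
  rwa [integral_map measurable_fst.aemeasurable i.aestronglyMeasurable] at s

lemma Apx.tendsto {X : Type*} [MetricSpace X] [SecondCountableTopology X]
    [MeasurableSpace X] [BorelSpace X] {a b : ℝ} {x₀ : X} {F : ℝ × X → ℝ}
    (hF : Measurable F) (h : Apx (lam a b) F)
    (ηs : ℕ → Measure (ℝ × X)) (η : Measure (ℝ × X))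
    (hηs : ∀ n, IsYoungMeasure a b x₀ (ηs n)) (hη : IsYoungMeasure a b x₀ η)
    (hconv : Y1Tendsto x₀ ηs η) :
    Tendsto (fun n => ∫ p, F p ∂(ηs n)) atTop (𝓝 (∫ p, F p ∂η)) := by
  rw [Metric.tendsto_atTop]
  intro ε hε
  obtain ⟨G, k, c, B, i, e, s⟩ := h (ε / 4) (by positivity)
  have hG : Tendsto (fun n => ∫ p, G p ∂(ηs n)) atTop (𝓝 (∫ p, G p ∂η)) := by
    refine hconv G c ?_
    obtain ⟨B, hB⟩ := B
    refine ⟨B, fun p => ?_⟩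
    have := hB p
    nlinarith [abs_nonneg (G p), dist_nonneg (x := x₀) (y := p.2)]
  rw [Metric.tendsto_atTop] at hG
  obtain ⟨N, hN⟩ := hG (ε / 4) (by positivity)
  refine ⟨N, fun n hn => ?_⟩
  have h1 := hN n hn
  have := (hηs n).1
  have := hη.1
  have h2 := (Apx.integrable hF h (ηs n) (hηs n).2.1).2 (ε / 4) (by positivity) G k c B i e s
  have h3 := (Apx.integrable hF h η hη.2.1).2 (ε / 4) (by positivity) G k c B i e s
  rw [Real.dist_eq] at *
  rw [abs_lt] at *
  rw [abs_le] at *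
  constructor <;> linarith [h1.1, h1.2, h2.1, h2.2, h3.1, h3.2]

/-- Time part of the approximating products. -/
def gfun {X : Type*} [MetricSpace X] (φ : ℝ × X → ℝ) (D : ℕ → X) (j : ℕ × ℕ × ℕ) (t : ℝ) : ℝ :=
  ⨅ l : ℕ, if dist (D l) (D j.1) * (j.2.1 + 1) < 1 then min (j.2.2 : ℝ) (φ (t, D l)) else j.2.2

/-- Space part of the approximating products. -/
def hfun {X : Type*} [MetricSpace X] (D : ℕ → X) (j : ℕ × ℕ × ℕ) (x : X) : ℝ :=
  max 0 (1 - dist x (D j.1) * (j.2.1 + 1))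

/-- Running maxima. -/
def runMax {α : Type*} (u : ℕ → α → ℝ) : ℕ → α → ℝ
  | 0 => fun _ => 0
  | n + 1 => fun p => max (runMax u n p) (u n p)

lemma gfun_bdd {X : Type*} [MetricSpace X] {φ : ℝ × X → ℝ} (h0 : ∀ p, 0 ≤ φ p) (D : ℕ → X)
    (j : ℕ × ℕ × ℕ) (t : ℝ) : BddBelow (range fun l : ℕ =>
      if dist (D l) (D j.1) * (j.2.1 + 1) < 1 then min (j.2.2 : ℝ) (φ (t, D l)) else j.2.2) := by
  refine ⟨0, ?_⟩
  rintro _ ⟨l, rfl⟩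
  dsimp only
  split_ifs
  · exact le_min (by positivity) (h0 _)
  · positivity

lemma gfun_nonneg {X : Type*} [MetricSpace X] {φ : ℝ × X → ℝ} (h0 : ∀ p, 0 ≤ φ p) (D : ℕ → X)
    (j : ℕ × ℕ × ℕ) (t : ℝ) : 0 ≤ gfun φ D j t := by
  refine le_ciInf fun l => ?_
  split_ifs
  · exact le_min (by positivity) (h0 _)
  · positivity

lemma gfun_le {X : Type*} [MetricSpace X] {φ : ℝ × X → ℝ} (h0 : ∀ p, 0 ≤ φ p) (D : ℕ → X)
    (j : ℕ × ℕ × ℕ) (t : ℝ) : gfun φ D j t ≤ j.2.2 := by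
  refine (ciInf_le (gfun_bdd h0 D j t) 0).trans ?_
  split_ifs
  · exact min_le_left _ _
  · exact le_rfl

lemma gfun_measurable {X : Type*} [MetricSpace X] [MeasurableSpace X]
    {φ : ℝ × X → ℝ} (hφ : Measurable φ) (D : ℕ → X)
    (j : ℕ × ℕ × ℕ) : Measurable (gfun φ D j) := by
  unfold gfun
  refine Measurable.iInf fun l => ?_
  split_ifs
  · exact measurable_const.min (hφ.comp (measurable_id.prodMk measurable_const))
  · exact measurable_const

lemma prod_le {X : Type*} [MetricSpace X] {φ : ℝ × X → ℝ} (h0 : ∀ p, 0 ≤ φ p)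
    (hc : ∀ t, Continuous fun x => φ (t, x)) {D : ℕ → X} (hD : DenseRange D)
    (j : ℕ × ℕ × ℕ) (p : ℝ × X) : gfun φ D j p.1 * hfun D j p.2 ≤ φ p := by
  obtain ⟨t, x⟩ := p
  by_cases hx : dist x (D j.1) * (j.2.1 + 1) < 1
  · have hg : gfun φ D j t ≤ φ (t, x) := by
      refine le_of_forall_pos_lt_add fun δ hδ => ?_
      have o1 : IsOpen {y | dist y (D j.1) * (j.2.1 + 1) < 1} :=
        isOpen_lt (by fun_prop) continuous_const
      have o2 : IsOpen {y | φ (t, y) < φ (t, x) + δ} := isOpen_lt (hc t) continuous_const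
      obtain ⟨l, hl1, hl2⟩ := hD.exists_mem_open (o1.inter o2) ⟨x, hx, by simpa using hδ⟩
      refine (ciInf_le (gfun_bdd h0 D j t) l).trans_lt ?_
      have hl1 : dist (D l) (D j.1) * (j.2.1 + 1) < 1 := hl1
      rw [if_pos hl1]
      exact (min_le_right _ _).trans_lt hl2
    have h1 : hfun D j x ≤ 1 := by
      refine max_le zero_le_one ?_
      have : 0 ≤ dist x (D j.1) * ((j.2.1 : ℝ) + 1) := by positivity
      linarith
    have h2 : 0 ≤ hfun D j x := le_max_left _ _
    have h3 := gfun_nonneg h0 D j t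
    change gfun φ D j t * hfun D j x ≤ _
    nlinarith
  · have : hfun D j x = 0 := max_eq_left (by linarith)
    simp [this, h0]

lemma prod_sup {X : Type*} [MetricSpace X] {φ : ℝ × X → ℝ} (h0 : ∀ p, 0 ≤ φ p)
    (hc : ∀ t, Continuous fun x => φ (t, x)) {D : ℕ → X} (hD : DenseRange D)
    (p : ℝ × X) (c : ℝ) (hcp : c < φ p) : ∃ j, c ≤ gfun φ D j p.1 * hfun D j p.2 := by
  obtain ⟨t, x⟩ := p
  rcases lt_or_ge c 0 with h | h
  · exact ⟨(0, 0, 0), h.le.trans (mul_nonneg (gfun_nonneg h0 D _ _) (le_max_left _ _))⟩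
  obtain ⟨d, hcd, hd⟩ := exists_between hcp
  have hd0 : 0 < d := h.trans_lt hcd
  obtain ⟨N, hN⟩ := exists_nat_ge d
  have o2 : IsOpen {y | d < φ (t, y)} := isOpen_lt continuous_const (hc t)
  obtain ⟨r, hr, hball⟩ := Metric.isOpen_iff.1 o2 x hd
  obtain ⟨k, hk⟩ := exists_nat_gt (2 / r)
  have hk' : 2 < r * ((k : ℝ) + 1) := by
    rw [div_lt_iff₀ hr] at hk; nlinarith
  have hk0 : (0 : ℝ) < k + 1 := by positivity
  have o3 : IsOpen {y | d * (dist x y * (k + 1)) < d - c} :=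
    isOpen_lt (by fun_prop) continuous_const
  obtain ⟨i, hi⟩ := hD.exists_mem_open o3 ⟨x, by simpa using hcd⟩
  have hi : d * (dist x (D i) * (k + 1)) < d - c := hi
  have hi1 : dist x (D i) * (k + 1) < 1 := by
    by_contra hcon
    push Not at hcon
    nlinarith
  refine ⟨(i, k, N), ?_⟩
  have hg : d ≤ gfun φ D (i, k, N) t := by
    refine le_ciInf fun l => ?_
    split_ifs with hl
    · refine le_min hN (le_of_lt (hball ?_))
      rw [Metric.mem_ball]
      have h1 := dist_triangle (D l) (D i) x
      rw [dist_comm (D i) x] at h1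
      have hl : dist (D l) (D i) * (k + 1) < 1 := hl
      by_contra hcon
      push Not at hcon
      nlinarith
    · exact hN
  have hh : 1 - dist x (D i) * (k + 1) ≤ hfun D (i, k, N) x := le_max_right _ _
  change c ≤ gfun φ D (i, k, N) t * hfun D (i, k, N) x
  calc c ≤ d * (1 - dist x (D i) * (k + 1)) := by linarith
    _ ≤ _ := mul_le_mul hg hh (by linarith) (hd0.le.trans hg)

lemma lsc {X : Type*} [MetricSpace X] [SecondCountableTopology X]
    [MeasurableSpace X] [BorelSpace X] {a b : ℝ} {x₀ : X} {φ : ℝ × X → ℝ}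
    (hab : a < b) (h0 : ∀ p, 0 ≤ φ p) (hm : Measurable φ)
    (hc : ∀ t, Continuous fun x => φ (t, x))
    (ηs : ℕ → Measure (ℝ × X)) (η : Measure (ℝ × X))
    (hηs : ∀ n, IsYoungMeasure a b x₀ (ηs n)) (hη : IsYoungMeasure a b x₀ η)
    (hconv : Y1Tendsto x₀ ηs η) (hi : Integrable φ η) (his : ∀ n, Integrable φ (ηs n))
    (ε : ℝ) (hε : 0 < ε) : ∀ᶠ n in atTop, ∫ p, φ p ∂η - ε < ∫ p, φ p ∂(ηs n) := by
  have : Nonempty X := ⟨x₀⟩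
  have := hη.1
  have hfin : IsFiniteMeasure (lam a b) := by rw [← hη.2.1]; infer_instance
  set D := TopologicalSpace.denseSeq X
  have hD : DenseRange D := TopologicalSpace.denseRange_denseSeq X
  let u : ℕ → ℝ × X → ℝ := fun n p =>
    gfun φ D (Denumerable.ofNat (ℕ × ℕ × ℕ) n) p.1 * hfun D (Denumerable.ofNat (ℕ × ℕ × ℕ) n) p.2
  have hhc : ∀ j, Continuous (hfun D j) := fun j => by unfold hfun; fun_prop
  have hum : ∀ n, Measurable (u n) := fun n =>
    ((gfun_measurable hm D _).comp measurable_fst).mul ((hhc _).measurable.comp measurable_snd)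
  have hua : ∀ n, Apx (lam a b) (u n) := by
    intro n
    refine Apx.prod ?_ (hhc _) ?_
    · refine Integrable.of_bound (gfun_measurable hm D _).aestronglyMeasurable
        (Denumerable.ofNat (ℕ × ℕ × ℕ) n).2.2 (Eventually.of_forall fun t => ?_)
      rw [Real.norm_eq_abs, abs_of_nonneg (gfun_nonneg h0 _ _ _)]
      exact gfun_le h0 _ _ _
    · intro x
      rw [abs_of_nonneg (le_max_left _ _)]
      refine max_le zero_le_one ?_
      have := mul_nonneg (dist_nonneg (x := x) (y := D (Denumerable.ofNat (ℕ × ℕ × ℕ) n).1))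
        (by positivity : (0 : ℝ) ≤ ((Denumerable.ofNat (ℕ × ℕ × ℕ) n).2.1 : ℝ) + 1)
      linarith
  have hFm : ∀ n, Measurable (runMax u n) := by
    intro n
    induction n with
    | zero => exact measurable_const
    | succ n ih => exact ih.max (hum n)
  have hFa : ∀ n, Apx (lam a b) (runMax u n) := by
    intro n
    induction n with
    | zero => exact Apx.zero _
    | succ n ih => exact ih.max (hua n)
  have hFle : ∀ n p, runMax u n p ≤ φ p := by
    intro n p
    induction n with
    | zero => exact h0 p
    | succ n ih => exact max_le ih (prod_le h0 hc hD _ p)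
  have hmono : ∀ p, Monotone fun n => runMax u n p := fun p =>
    monotone_nat_of_le_succ fun n => le_max_left _ _
  have hlim : ∀ p, Tendsto (fun n => runMax u n p) atTop (𝓝 (φ p)) := by
    intro p
    refine tendsto_order.2 ⟨fun c hcp => ?_, fun c hcp =>
      Eventually.of_forall fun n => (hFle n p).trans_lt hcp⟩
    obtain ⟨d, hcd, hd⟩ := exists_between hcp
    obtain ⟨j, hj⟩ := prod_sup h0 hc hD p d hd
    filter_upwards [eventually_ge_atTop (Encodable.encode j + 1)] with n hn
    refine hcd.trans_le (le_trans ?_ (hmono p hn))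
    refine le_trans ?_ (le_max_right _ _)
    simpa only [u, Denumerable.ofNat_encode] using hj
  have hFi : ∀ n, Integrable (runMax u n) η := fun n =>
    (Apx.integrable (hFm n) (hFa n) η hη.2.1).1
  have hint := integral_tendsto_of_tendsto_of_monotone hFi hi
    (Eventually.of_forall hmono) (Eventually.of_forall hlim)
  obtain ⟨m, hm'⟩ := (hint.eventually (lt_mem_nhds (sub_lt_self _ hε))).exists
  have ht := Apx.tendsto (hFm m) (hFa m) ηs η hηs hη hconv
  filter_upwards [ht.eventually (lt_mem_nhds hm')] with n hn
  have := (hηs n).1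
  exact hn.trans_le (integral_mono (Apx.integrable (hFm m) (hFa m) (ηs n) (hηs n).2.1).1
    (his n) (hFle m))

/-- If `f` is a Caratheodory integrand (Borel, continuous in the second variable) with
`|f(t,x)| ≤ C (1 + d(x₀,x))`, then `η ↦ ∫ f dη` is (sequentially) continuous on the
space `𝒴₁(I,X)` of Young measures. -/
theorem caratheodory_integrand_continuous
    {X : Type*} [MetricSpace X] [CompleteSpace X] [SecondCountableTopology X]
    [MeasurableSpace X] [BorelSpace X]
    (a b : ℝ) (hab : a < b) (x₀ : X)
    (f : ℝ × X → ℝ) (hfBorel : Measurable f)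
    (hfCar : ∀ t : ℝ, Continuous fun x => f (t, x))
    (C : ℝ) (hgrowth : ∀ t ∈ Icc a b, ∀ x : X, |f (t, x)| ≤ C * (1 + dist x₀ x))
    (ηs : ℕ → Measure (ℝ × X)) (η : Measure (ℝ × X))
    (hηs : ∀ n, IsYoungMeasure a b x₀ (ηs n)) (hη : IsYoungMeasure a b x₀ η)
    (hconv : Y1Tendsto x₀ ηs η) :
    Tendsto (fun n => ∫ p, f p ∂(ηs n)) atTop (𝓝 (∫ p, f p ∂η)) := by
  classical
  have hC : 0 ≤ C := by
    have := (abs_nonneg _).trans (hgrowth a ⟨le_rfl, hab.le⟩ x₀)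
    simpa using this
  let f' : ℝ × X → ℝ := fun p => if p.1 ∈ Icc a b then f p else 0
  have hf'm : Measurable f' :=
    Measurable.ite (measurable_fst measurableSet_Icc) hfBorel measurable_const
  have hf'c : ∀ t, Continuous fun x => f' (t, x) := by
    intro t
    by_cases ht : t ∈ Icc a b
    · simpa only [f', ht, if_true] using hfCar t
    · simpa only [f', ht, if_false] using continuous_const
  have hf'b : ∀ p, |f' p| ≤ C * (1 + dist x₀ p.2) := by
    rintro ⟨t, x⟩
    by_cases ht : t ∈ Icc a b
    · simpa only [f', ht, if_true] using hgrowth t ht x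
    · simp only [f', ht, if_false, abs_zero]
      positivity
  let w : ℝ × X → ℝ := fun p => C * (1 + dist x₀ p.2)
  have hwc : Continuous w := by fun_prop
  have hwi : ∀ ν, IsYoungMeasure a b x₀ ν → Integrable w ν := by
    intro ν hν
    have := hν.1
    exact ((integrable_const 1).add hν.2.2).const_mul C
  have hf'i : ∀ ν, IsYoungMeasure a b x₀ ν → Integrable f' ν := fun ν hν =>
    (hwi ν hν).mono' hf'm.aestronglyMeasurable (Eventually.of_forall hf'b)
  have heq : ∀ ν, IsYoungMeasure a b x₀ ν → ∫ p, f p ∂ν = ∫ p, f' p ∂ν := by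
    intro ν hν
    refine integral_congr_ae ?_
    have h1 : ∀ᵐ t ∂(lam a b), t ∈ Icc a b :=
      Measure.ae_smul_measure (ae_restrict_mem measurableSet_Icc) _
    rw [← hν.2.1] at h1
    filter_upwards [ae_of_ae_map measurable_fst.aemeasurable h1] with p hp
    simp only [f', hp, if_true]
  rw [heq η hη]
  simp_rw [fun n => heq (ηs n) (hηs n)]
  have hw := hconv w hwc ⟨C, fun p => by
    rw [abs_of_nonneg (by positivity)]⟩
  rw [Metric.tendsto_nhds] at hw ⊢
  intro ε hε
  have L1 := lsc (φ := fun p => w p + f' p) hab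
    (fun p => by have := abs_le.1 (hf'b p); simp only [w]; linarith [this.1])
    (hwc.measurable.add hf'm) (fun t => (hwc.comp (by fun_prop)).add (hf'c t))
    ηs η hηs hη hconv ((hwi _ hη).add (hf'i _ hη))
    (fun n => (hwi _ (hηs n)).add (hf'i _ (hηs n))) (ε / 2) (by positivity)
  have L2 := lsc (φ := fun p => w p - f' p) hab
    (fun p => by have := abs_le.1 (hf'b p); simp only [w]; linarith [this.2])
    (hwc.measurable.sub hf'm) (fun t => (hwc.comp (by fun_prop)).sub (hf'c t))
    ηs η hηs hη hconv ((hwi _ hη).sub (hf'i _ hη))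
    (fun n => (hwi _ (hηs n)).sub (hf'i _ (hηs n))) (ε / 2) (by positivity)
  filter_upwards [hw (ε / 2) (by positivity), L1, L2] with n h1 h2 h3
  rw [integral_add (hwi _ hη) (hf'i _ hη), integral_add (hwi _ (hηs n)) (hf'i _ (hηs n))] at h2
  rw [integral_sub (hwi _ hη) (hf'i _ hη), integral_sub (hwi _ (hηs n)) (hf'i _ (hηs n))] at h3
  rw [Real.dist_eq, abs_lt] at h1 ⊢
  constructor <;> linarith [h1.1, h1.2]
end
end

section
/- Let (X,d) be a complete separable metric space, I=[a,b] a compact interval with normalized Lebesgue measure λ, and let f: I×X → (-∞,∞] be a normal integrand (a Borel function lower semi-continuous in the second variable) such that f(t,x)/(1+d(x₀,x)) is bounded from below for some x₀ ∈ X. Then the map η ↦ ∫_{I×X} f dη is lower semi-continuous on the space 𝒴₁(I,X) of Young measures. -/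
open MeasureTheory Filter Topology Set ENNReal

noncomputable section

/-- The nonnegative part of an extended real, as an `ℝ≥0∞`. -/
def epos (x : EReal) : ℝ≥0∞ := if x = ⊤ then ⊤ else ENNReal.ofReal x.toReal

/-- The integral of an `EReal`-valued function: positive part minus negative part. -/
def eInt {α : Type*} [MeasurableSpace α] (μ : Measure α) (f : α → EReal) : EReal :=
  ((∫⁻ x, epos (f x) ∂μ : ℝ≥0∞) : EReal) - ((∫⁻ x, epos (-f x) ∂μ : ℝ≥0∞) : EReal)

lemma exists_compact_of_lt_range (g : (ℕ → ℕ) → ℝ) (hg : Continuous g) (μ : Measure ℝ)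
    [IsFiniteMeasure μ] (c : ℝ≥0∞) (hc : c < μ (range g)) :
    ∃ K : Set ℝ, IsCompact K ∧ K ⊆ range g ∧ c ≤ μ K := by
  have step : ∀ (S : Set (ℕ → ℕ)) (k : ℕ), ∃ m : ℕ, c < μ (g '' S) →
      c < μ (g '' (S ∩ {x | x k ≤ m})) := by
    intro S k
    by_cases h : c < μ (g '' S)
    · have hU : g '' S = ⋃ m : ℕ, g '' (S ∩ {x | x k ≤ m}) := by
        rw [← image_iUnion, ← inter_iUnion]
        congr 1
        ext x
        simp only [mem_inter_iff, mem_iUnion, mem_ofPred_eq]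
        exact ⟨fun hx => ⟨hx, x k, le_rfl⟩, fun hx => hx.1⟩
      have hmono : Monotone fun m : ℕ => g '' (S ∩ {x | x k ≤ m}) := by
        intro m m' hm
        apply image_mono
        exact inter_subset_inter_right _ fun x (hx : x k ≤ m) => le_trans hx hm
      rw [hU, hmono.measure_iUnion] at h
      obtain ⟨m, hm⟩ := lt_iSup_iff.1 h
      exact ⟨m, fun _ => hm⟩
    · exact ⟨0, fun h' => absurd h' h⟩
  choose m hm using step
  let S : ℕ → Set (ℕ → ℕ) := fun k => Nat.rec univ (fun k T => T ∩ {x | x k ≤ m T k}) k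
  have hS1 : ∀ k, S (k + 1) = S k ∩ {x | x k ≤ m (S k) k} := fun k => rfl
  have hSc : ∀ k, c < μ (g '' S k) := by
    intro k
    induction k with
    | zero => simpa [S] using hc
    | succ k ih => rw [hS1]; exact hm _ _ ih
  let n : ℕ → ℕ := fun k => m (S k) k
  have hSn : ∀ k, S k = {x | ∀ i < k, x i ≤ n i} := by
    intro k
    induction k with
    | zero => ext x; simp [S]
    | succ k ih =>
      ext x
      rw [hS1]
      constructor
      · rintro ⟨h1, h2⟩ i hi
        rw [ih] at h1
        rcases Nat.lt_succ_iff_lt_or_eq.1 hi with h | h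
        · exact h1 i h
        · subst h; exact h2
      · intro h
        refine ⟨?_, h k (Nat.lt_succ_self k)⟩
        rw [ih]
        exact fun i hi => h i (hi.trans (Nat.lt_succ_self k))
  let K : Set (ℕ → ℕ) := Set.pi univ fun i => Iic (n i)
  have hK : IsCompact K := isCompact_univ_pi fun i => (finite_Iic (n i)).isCompact
  refine ⟨g '' K, hK.image hg, image_subset_range _ _, ?_⟩
  rw [(g '' K).measure_eq_iInf_isOpen]
  refine le_iInf fun O => le_iInf fun hO => le_iInf fun hOo => ?_
  have hex : ∃ k, S k ⊆ g ⁻¹' O := by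
    by_contra! hcon
    have : ∀ k, ∃ x, x ∈ S k ∧ x ∉ g ⁻¹' O := fun k => not_subset.1 (hcon k)
    choose x hxS hxO using this
    let z : ℕ → ℕ → ℕ := fun k i => min (x k i) (n i)
    have hz : ∀ k, z k ∈ K := fun k i _ => mem_Iic.2 (min_le_right _ _)
    obtain ⟨w, hw, φ, hφ, hlim⟩ := hK.tendsto_subseq hz
    have hlim' : Tendsto (fun j => x (φ j)) atTop (𝓝 w) := by
      rw [tendsto_pi_nhds] at hlim ⊢
      intro i
      refine (hlim i).congr' ?_
      filter_upwards [eventually_gt_atTop i] with j hj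
      have := hxS (φ j)
      rw [hSn] at this
      exact min_eq_left (this i (hj.trans_le (hφ.id_le j)))
    have hwO : g ⁻¹' O ∈ 𝓝 w := (hOo.preimage hg).mem_nhds (hO (mem_image_of_mem g hw))
    obtain ⟨j, hj⟩ := (hlim'.eventually_mem hwO).exists
    exact hxO _ hj
  obtain ⟨k, hk⟩ := hex
  exact (hSc k).le.trans (measure_mono (image_subset_iff.2 hk))

lemma analytic_nullMeasurable (A : Set ℝ) (hA : AnalyticSet A) (μ : Measure ℝ)
    [IsFiniteMeasure μ] : NullMeasurableSet A μ := by
  rw [analyticSet_iff_exists_polishSpace_range] at hA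
  have hA' : AnalyticSet A := by rw [analyticSet_iff_exists_polishSpace_range]; exact hA
  rw [AnalyticSet] at hA'
  rcases hA' with rfl | ⟨g, hg, rfl⟩
  · exact MeasurableSet.empty.nullMeasurableSet
  rcases eq_or_ne (μ (range g)) 0 with h0 | h0
  · exact NullMeasurableSet.of_null h0
  obtain ⟨u, -, hu, hul⟩ := exists_seq_strictMono_tendsto' (pos_iff_ne_zero.2 h0)
  choose K hKc hKs hKm using fun k => exists_compact_of_lt_range g hg μ (u k) (hu k).2
  have hBm : MeasurableSet (⋃ k, K k) := MeasurableSet.iUnion fun k => (hKc k).measurableSet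
  have hBs : (⋃ k, K k) ⊆ range g := iUnion_subset hKs
  have hle : μ (range g) ≤ μ (⋃ k, K k) :=
    le_of_tendsto' hul fun k => (hKm k).trans (measure_mono (subset_iUnion K k))
  have := ae_eq_of_subset_of_measure_ge hBs hle hBm.nullMeasurableSet (measure_ne_top _ _)
  exact hBm.nullMeasurableSet.congr this

lemma open_sections_lsc {X : Type*} [MetricSpace X] [CompleteSpace X] [SecondCountableTopology X]
    [MeasurableSpace X] [BorelSpace X] (x₀ : X)
    (ν : Measure ℝ) [IsFiniteMeasure ν]
    (ηs : ℕ → Measure (ℝ × X)) (η : Measure (ℝ × X))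
    (hp : ∀ n, IsProbabilityMeasure (ηs n)) (hp' : IsProbabilityMeasure η)
    (hm : ∀ n, (ηs n).map Prod.fst = ν) 
    (hconv : ∀ f : BoundedContinuousFunction (ℝ × X) ℝ, 
      Tendsto (fun n => ∫ p, f p ∂(ηs n)) atTop (𝓝 (∫ p, f p ∂η)))
    (U : Set (ℝ × X)) (hU : MeasurableSet U) (hUo : ∀ t, IsOpen {x | (t, x) ∈ U}) :
    η U ≤ liminf (fun n => ηs n U) atTop := by
  obtain ⟨V, hV⟩ := (TopologicalSpace.countable_countableBasis X).exists_eq_range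
    (by
      obtain ⟨v, hv, -⟩ := (TopologicalSpace.isBasis_countableBasis X).exists_subset_of_mem_open
        (mem_univ x₀) isOpen_univ
      exact ⟨v, hv⟩)
  have hVb : TopologicalSpace.IsTopologicalBasis (range V) :=
    hV ▸ TopologicalSpace.isBasis_countableBasis X
  have hVo : ∀ j, IsOpen (V j) := fun j => hVb.isOpen (mem_range_self j)
  let A : ℕ → Set ℝ := fun j => (Prod.fst '' (Uᶜ ∩ (univ ×ˢ V j)))ᶜ
  have hAmem : ∀ j t, t ∈ A j ↔ ∀ x ∈ V j, (t, x) ∈ U := by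
    intro j t
    simp only [A, mem_compl_iff, mem_image, mem_inter_iff, mem_prod, mem_univ, true_and,
      Prod.exists, exists_and_right, exists_eq_right, not_exists, not_and]
    constructor
    · intro h x hx
      by_contra hc
      exact h x hc hx
    · intro h x hx hx'
      exact hx (h x hx')
  have hAn : ∀ j, NullMeasurableSet (A j) ν := by
    intro j
    refine (analytic_nullMeasurable _ ?_ ν).compl
    refine AnalyticSet.image_of_continuous ?_ continuous_fst
    exact (hU.compl.inter (MeasurableSet.univ.prod (hVo j).measurableSet)).analyticSet
  refine ENNReal.le_of_forall_pos_le_add fun ε hε _ => ?_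
  obtain ⟨δ, hδ, hδs⟩ := ENNReal.exists_pos_sum_of_countable' 
    (ENNReal.coe_ne_zero.2 hε.ne') ℕ
  have hO : ∀ j, ∃ O, A j ⊆ O ∧ IsOpen O ∧ ν (O \ A j) ≤ δ j := by
    intro j
    obtain ⟨O, hAO, hOo, hlt⟩ := (A j).exists_isOpen_lt_add (measure_ne_top ν _) (hδ j).ne'
    refine ⟨O, hAO, hOo, ?_⟩
    rw [measure_sdiff hAO (hAn j) (measure_ne_top _ _)]
    exact tsub_le_iff_left.2 hlt.le
  choose O hAO hOo hOd using hO
  let W : Set (ℝ × X) := ⋃ j, O j ×ˢ V j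
  have hW : IsOpen W := isOpen_iUnion fun j => (hOo j).prod (hVo j)
  have hUW : U ⊆ W := by
    rintro ⟨t, x⟩ h
    obtain ⟨v, ⟨j, rfl⟩, hxv, hvs⟩ := hVb.exists_subset_of_mem_open (show x ∈ {x | (t, x) ∈ U} from h) (hUo t)
    exact mem_iUnion.2 ⟨j, hAO j ((hAmem j t).2 fun y hy => hvs hy), hxv⟩
  have hWU : W ⊆ U ∪ ⋃ j, Prod.fst ⁻¹' (O j \ A j) := by
    rintro ⟨t, x⟩ h
    obtain ⟨j, hj1, hj2⟩ := mem_iUnion.1 h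
    by_cases ht : t ∈ A j
    · exact Or.inl ((hAmem j t).1 ht x hj2)
    · exact Or.inr (mem_iUnion.2 ⟨j, hj1, ht⟩)
  have hbound : ∀ n, ηs n W ≤ ηs n U + ε := by
    intro n
    refine (measure_mono hWU).trans ((measure_union_le _ _).trans ?_)
    gcongr
    refine (measure_iUnion_le _).trans (le_trans (ENNReal.tsum_le_tsum fun j => ?_) hδs.le)
    rw [← Measure.map_apply₀ measurable_fst.aemeasurable, hm n]
    · exact hOd j
    · rw [hm n]; exact (hOo j).measurableSet.nullMeasurableSet.diff (hAn j)
  let P : ProbabilityMeasure (ℝ × X) := ⟨η, hp'⟩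
  let Ps : ℕ → ProbabilityMeasure (ℝ × X) := fun n => ⟨ηs n, hp n⟩
  have hP : Tendsto Ps atTop (𝓝 P) :=
    ProbabilityMeasure.tendsto_iff_forall_integral_tendsto.2 hconv
  calc η U ≤ η W := measure_mono hUW
    _ ≤ liminf (fun n => ηs n W) atTop := 
      ProbabilityMeasure.le_liminf_measure_open_of_tendsto hP hW
    _ ≤ liminf (fun n => ηs n U + ε) atTop := liminf_le_liminf (Eventually.of_forall hbound)
    _ = liminf (fun n => ηs n U) atTop + ε := by
      apply liminf_add_const <;> isBoundedDefault

lemma lintegral_lsc {X : Type*} [MetricSpace X] [MeasurableSpace X]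
    (ηs : ℕ → Measure (ℝ × X)) (η : Measure (ℝ × X))
    (hset : ∀ U : Set (ℝ × X), MeasurableSet U → (∀ t, IsOpen {x | (t, x) ∈ U}) →
      η U ≤ liminf (fun n => ηs n U) atTop)
    (G : ℝ × X → ℝ≥0∞) (hG : Measurable G) (hGl : ∀ t, LowerSemicontinuous fun x => G (t, x)) :
    ∫⁻ p, G p ∂η ≤ liminf (fun n => ∫⁻ p, G p ∂(ηs n)) atTop := by
  have key : ∀ M : ℕ, ∫⁻ p, min (G p) M ∂η ≤ liminf (fun n => ∫⁻ p, G p ∂(ηs n)) atTop := by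
    intro M
    have hfin : ∀ p, min (G p) M ≠ ⊤ := fun p =>
      ((min_le_right _ _).trans_lt (ENNReal.natCast_lt_top M)).ne
    have hmeas : Measurable fun p => (min (G p) M).toReal := 
      (hG.min measurable_const).ennreal_toReal
    have hl : ∀ μ : Measure (ℝ × X), ∫⁻ p, min (G p) M ∂μ =
        ∫⁻ t in Ioi (0:ℝ), μ {p | t < (min (G p) M).toReal} := by
      intro μ
      rw [← lintegral_eq_lintegral_meas_lt μ (Eventually.of_forall fun p => toReal_nonneg)
        hmeas.aemeasurable]
      exact lintegral_congr fun p => (ENNReal.ofReal_toReal (hfin p)).symm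
    calc ∫⁻ p, min (G p) M ∂η = ∫⁻ t in Ioi (0:ℝ), η {p | t < (min (G p) M).toReal} := hl η
      _ ≤ ∫⁻ t in Ioi (0:ℝ), liminf (fun n => ηs n {p | t < (min (G p) M).toReal}) atTop := by
        refine setLIntegral_mono' measurableSet_Ioi fun t ht => ?_
        refine hset _ (measurableSet_lt measurable_const hmeas) fun s => ?_
        have : {x | (s, x) ∈ {p : ℝ × X | t < (min (G p) M).toReal}} =
            {x | ENNReal.ofReal t < G (s, x)} ∩ {_x | ENNReal.ofReal t < M} := by
          ext x
          show t < (min (G (s, x)) M).toReal ↔ (ENNReal.ofReal t < G (s, x) ∧ ENNReal.ofReal t < M)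
          rw [← ENNReal.ofReal_lt_iff_lt_toReal (le_of_lt ht) (hfin _), lt_min_iff]
        rw [this]
        exact ((hGl s).isOpen_preimage _).inter isOpen_const
      _ ≤ liminf (fun n => ∫⁻ t in Ioi (0:ℝ), ηs n {p | t < (min (G p) M).toReal}) atTop := 
        lintegral_liminf_le fun n => Antitone.measurable fun s t hst =>
          measure_mono fun p hp => lt_of_le_of_lt hst hp
      _ = liminf (fun n => ∫⁻ p, min (G p) M ∂(ηs n)) atTop := by simp_rw [hl]
      _ ≤ _ := liminf_le_liminf (Eventually.of_forall fun n => 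
        lintegral_mono fun p => min_le_left _ _)
  have hsup : ∀ p, G p = ⨆ M : ℕ, min (G p) M := by
    intro p
    have := inf_iSup_eq (G p) (fun M : ℕ => (M : ℝ≥0∞))
    rw [ENNReal.iSup_natCast] at this
    simpa using this
  calc ∫⁻ p, G p ∂η = ∫⁻ p, ⨆ M : ℕ, min (G p) M ∂η := lintegral_congr hsup
    _ = ⨆ M : ℕ, ∫⁻ p, min (G p) M ∂η := by
      refine lintegral_iSup (fun M => hG.min measurable_const) ?_
      intro M N h p
      exact min_le_min le_rfl (by exact_mod_cast h)
    _ ≤ _ := iSup_le key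

lemma toENNReal_decomp (y : EReal) (h : ℝ) (hy : (h : EReal) ≤ y) :
    y.toENNReal + ENNReal.ofReal (-h) =
      (-y).toENNReal + ENNReal.ofReal h + (y - h).toENNReal := by
  induction y with
  | bot => simp at hy
  | top => simp
  | coe y =>
    have hy' : h ≤ y := by exact_mod_cast hy
    rw [← EReal.coe_neg, ← EReal.coe_sub]
    simp only [EReal.real_coe_toENNReal]
    rcases le_total 0 h with h0 | h0
    · have : 0 ≤ y := h0.trans hy'
      rw [ENNReal.ofReal_of_nonpos (by linarith : -h ≤ 0), 
        ENNReal.ofReal_of_nonpos (by linarith : -y ≤ 0), add_zero, zero_add,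
        ← ENNReal.ofReal_add h0 (by linarith)]
      congr 1; ring
    · rw [ENNReal.ofReal_of_nonpos h0]
      rcases le_total 0 y with y0 | y0
      · rw [ENNReal.ofReal_of_nonpos (by linarith : -y ≤ 0), zero_add, zero_add,
          ← ENNReal.ofReal_add y0 (by linarith)]
        congr 1
      · rw [ENNReal.ofReal_of_nonpos y0, zero_add, add_zero,
          ← ENNReal.ofReal_add (by linarith) (by linarith)]
        congr 1; ring

lemma eInt_eq {α : Type*} [MeasurableSpace α] (μ : Measure α) (f : α → EReal) (hf : Measurable f)
    (h : α → ℝ) (hh : Measurable h) (hi : Integrable h μ) (hle : ∀ᵐ p ∂μ, (h p : EReal) ≤ f p) :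
    eInt μ f = ((∫⁻ p, (f p - h p).toENNReal ∂μ : ℝ≥0∞) : EReal) + ((∫ p, h p ∂μ : ℝ) : EReal) := by
  have e : eInt μ f = ((∫⁻ x, (f x).toENNReal ∂μ : ℝ≥0∞) : EReal) -
    ((∫⁻ x, (-f x).toENNReal ∂μ : ℝ≥0∞) : EReal) := rfl
  rw [e, integral_eq_lintegral_pos_part_sub_lintegral_neg_part hi]
  have hHn : ∫⁻ p, ENNReal.ofReal (-h p) ∂μ ≠ ⊤ := hi.neg.lintegral_lt_top.ne
  have hHp : ∫⁻ p, ENNReal.ofReal (h p) ∂μ ≠ ⊤ := hi.lintegral_lt_top.ne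
  have hmn : Measurable fun p => ENNReal.ofReal (-h p) := hh.neg.ennreal_ofReal
  have hmp : Measurable fun p => ENNReal.ofReal (h p) := hh.ennreal_ofReal
  have hfn : Measurable fun p => (-f p).toENNReal := 
    EReal.continuous_toENNReal.measurable.comp hf.neg
  have hN : ∫⁻ p, (-f p).toENNReal ∂μ ≠ ⊤ := by
    refine (lt_of_le_of_lt (lintegral_mono_ae ?_) hHn.lt_top).ne
    filter_upwards [hle] with p hp
    rw [← EReal.real_coe_toENNReal, EReal.coe_neg]
    exact EReal.toENNReal_le_toENNReal (EReal.neg_le_neg_iff.2 hp)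
  have hsum : ∫⁻ p, (f p).toENNReal ∂μ + ∫⁻ p, ENNReal.ofReal (-h p) ∂μ =
      ∫⁻ p, (-f p).toENNReal ∂μ + ∫⁻ p, ENNReal.ofReal (h p) ∂μ + 
        ∫⁻ p, (f p - h p).toENNReal ∂μ := by
    rw [← lintegral_add_right _ hmn, ← lintegral_add_right _ hmp, 
      ← lintegral_add_left (f := fun p => (-f p).toENNReal + ENNReal.ofReal (h p)) (hfn.add hmp)]
    refine lintegral_congr_ae ?_
    filter_upwards [hle] with p hp
    exact toENNReal_decomp _ _ hp
  generalize ∫⁻ p, (f p).toENNReal ∂μ = P at *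
  generalize ∫⁻ p, (-f p).toENNReal ∂μ = N at *
  generalize ∫⁻ p, (f p - h p).toENNReal ∂μ = L at *
  generalize ∫⁻ p, ENNReal.ofReal (h p) ∂μ = A at *
  generalize ∫⁻ p, ENNReal.ofReal (-h p) ∂μ = B at *
  lift N to NNReal using hN
  lift A to NNReal using hHp
  lift B to NNReal using hHn
  induction L with
  | top =>
    have : P = ⊤ := by
      by_contra hP
      exact (ENNReal.add_ne_top.2 ⟨hP, ENNReal.coe_ne_top⟩) (by rw [hsum]; simp)
    subst this
    rw [EReal.coe_ennreal_top, EReal.top_add_coe]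
    exact EReal.top_sub_coe (N : ℝ)
  | coe L =>
    have : P ≠ ⊤ := by
      rintro rfl
      rw [top_add] at hsum
      exact absurd hsum.symm (by simp)
    lift P to NNReal using this
    have h1 : P + B = N + A + L := by exact_mod_cast hsum
    have h2 : (P:ℝ) + B = N + A + L := by exact_mod_cast h1
    show ((P:ℝ):EReal) - ((N:ℝ):EReal) = ((L:ℝ):EReal) + (((A:ℝ) - (B:ℝ) : ℝ):EReal)
    rw [← EReal.coe_sub, ← EReal.coe_add, EReal.coe_eq_coe_iff]
    linarith

/-- If `f` is a normal integrand (Borel, lower semicontinuous in the second variable,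
with values in `(-∞,∞]`) such that `f(t,x)/(1 + d(x₀,x))` is bounded from below, then
`η ↦ ∫ f dη` is (sequentially) lower semicontinuous on the space `𝒴₁(I,X)` of Young
measures. -/
theorem normal_integrand_lsc
    {X : Type*} [MetricSpace X] [CompleteSpace X] [SecondCountableTopology X]
    [MeasurableSpace X] [BorelSpace X]
    (a b : ℝ) (hab : a < b) (x₀ : X)
    (f : ℝ × X → EReal) (hfBorel : Measurable f)
    (hfnormal : ∀ t : ℝ, LowerSemicontinuous fun x => f (t, x))
    (C : ℝ) (hbelow : ∀ t ∈ Icc a b, ∀ x : X, ((C * (1 + dist x₀ x) : ℝ) : EReal) ≤ f (t, x))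
    (ηs : ℕ → Measure (ℝ × X)) (η : Measure (ℝ × X))
    (hηs : ∀ n, IsYoungMeasure a b x₀ (ηs n)) (hη : IsYoungMeasure a b x₀ η)
    (hconv : Y1Tendsto x₀ ηs η) :
    eInt η f ≤ Filter.liminf (fun n => eInt (ηs n) f) atTop := by
  have hlamf : IsFiniteMeasure (lam a b) := by
    rw [← hη.2.1]
    have := hη.1
    infer_instance
  have hset : ∀ U : Set (ℝ × X), MeasurableSet U → (∀ t, IsOpen {x | (t, x) ∈ U}) →
      η U ≤ liminf (fun n => ηs n U) atTop := by
    refine open_sections_lsc x₀ (lam a b) ηs η (fun n => (hηs n).1) hη.1 (fun n => (hηs n).2.1) ?_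
    intro g
    refine hconv g g.continuous ⟨‖g‖, fun p => ?_⟩
    have h1 : |g p| ≤ ‖g‖ := g.norm_coe_le_norm p
    nlinarith [norm_nonneg g, dist_nonneg (x := x₀) (y := p.2), 
      mul_nonneg (norm_nonneg g) (dist_nonneg (x := x₀) (y := p.2))]
  let h : ℝ × X → ℝ := fun p => C * (1 + dist x₀ p.2)
  have hc : Continuous h := by fun_prop
  have hint : ∀ μ : Measure (ℝ × X), IsYoungMeasure a b x₀ μ → Integrable h μ := by
    intro μ hμ
    have := hμ.1
    exact ((integrable_const 1).add hμ.2.2).const_mul C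
  have hle : ∀ μ : Measure (ℝ × X), IsYoungMeasure a b x₀ μ → ∀ᵐ p ∂μ, (h p : EReal) ≤ f p := by
    intro μ hμ
    have h1 : ∀ᵐ t ∂(μ.map Prod.fst), t ∈ Icc a b := by
      rw [hμ.2.1, lam]
      exact Measure.ae_smul_measure (ae_restrict_mem measurableSet_Icc) _
    have h2 := ae_of_ae_map measurable_fst.aemeasurable h1
    filter_upwards [h2] with p hp
    exact hbelow p.1 hp p.2
  have heq : ∀ μ : Measure (ℝ × X), IsYoungMeasure a b x₀ μ → eInt μ f =
      ((∫⁻ p, (f p - h p).toENNReal ∂μ : ℝ≥0∞) : EReal) + ((∫ p, h p ∂μ : ℝ) : EReal) :=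
    fun μ hμ => eInt_eq μ f hfBorel h hc.measurable (hint μ hμ) (hle μ hμ)
  have hG : Measurable fun p => (f p - h p).toENNReal := by
    refine EReal.continuous_toENNReal.measurable.comp ?_
    simp_rw [sub_eq_add_neg]
    exact hfBorel.add hc.measurable.coe_real_ereal.neg
  have hGl : ∀ t, LowerSemicontinuous fun x => (f (t, x) - h (t, x)).toENNReal := by
    intro t
    have hcont : Continuous fun x => (((-h (t, x) : ℝ)) : EReal) :=
      continuous_coe_real_ereal.comp (by fun_prop)
    have h1 : LowerSemicontinuous fun x => f (t, x) + ((-h (t, x) : ℝ) : EReal) :=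
      (hfnormal t).add' hcont.lowerSemicontinuous fun x => 
        EReal.continuousAt_add (by simp) (by simp)
    have h2 := EReal.continuous_toENNReal.comp_lowerSemicontinuous h1
      fun x y => EReal.toENNReal_le_toENNReal
    simpa [Function.comp_def, sub_eq_add_neg] using h2
  have hL := lintegral_lsc ηs η hset _ hG hGl
  have hH : Tendsto (fun n => ((∫ p, h p ∂(ηs n) : ℝ) : EReal)) atTop
      (𝓝 ((∫ p, h p ∂η : ℝ) : EReal)) := by
    refine (continuous_coe_real_ereal.tendsto _).comp (hconv h hc ⟨|C|, fun p => ?_⟩)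
    rw [abs_mul, abs_of_nonneg (by positivity : 0 ≤ 1 + dist x₀ p.2)]
  rw [heq η hη]
  have hfun : (fun n => eInt (ηs n) f) = 
      (fun n => ((∫⁻ p, (f p - h p).toENNReal ∂(ηs n) : ℝ≥0∞) : EReal)) +
        fun n => ((∫ p, h p ∂(ηs n) : ℝ) : EReal) := funext fun n => heq _ (hηs n)
  rw [hfun]
  refine le_trans ?_ EReal.le_liminf_add
  refine add_le_add ?_ hH.liminf_eq.ge
  refine (EReal.coe_ennreal_le_coe_ennreal_iff.2 hL).trans ?_
  exact (Monotone.map_liminf_of_continuousAt (fun x y => EReal.coe_ennreal_le_coe_ennreal_iff.2) _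
    continuous_coe_ennreal_ereal.continuousAt).le
end
end
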